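/- The composition operator f ↦ g·(f ∘ h), where h is a holomorphic self-map of a disk 𝒱 with h(𝒱̄) ⊂ 𝒱 and g is holomorphic on 𝒱 and continuous on 𝒱̄, has spectrum (acting on the Banach space of functions continuous on 𝒱̄ and holomorphic on 𝒱) equal to {g(x_h)·(h'(x_h))^n : n ≥ 0} ∪ {0}, where x_h is the unique fixed point of h in 𝒱. -/

import Mathlib

set_option synthInstance.maxHeartbeats 1000000
set_option maxHeartbeats 1000000

open Metric


instance (c : ℂ) (r : ℝ) : CompactSpace (closedBall c r) :=
  isCompact_iff_compactSpace.mp (isCompact_closedBall c r)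

/-- The space `A_∞(𝒱)`: continuous functions on the closed disk, holomorphic
on the open disk, as a submodule of `C(closedBall c r, ℂ)` (sup norm). -/
noncomputable def discAlg (c : ℂ) (r : ℝ) : Submodule ℂ C(closedBall c r, ℂ) where
  carrier := {f | ∃ F : ℂ → ℂ, ContinuousOn F (closedBall c r) ∧
      DifferentiableOn ℂ F (ball c r) ∧ ∀ z : closedBall c r, f z = F z}
  add_mem' := by
    rintro f g ⟨F, hFc, hFd, hF⟩ ⟨G, hGc, hGd, hG⟩
    exact ⟨F + G, hFc.add hGc, hFd.add hGd, fun z => by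
      simp [ContinuousMap.add_apply, hF z, hG z]⟩
  zero_mem' := ⟨0, continuousOn_const, differentiableOn_const 0, fun z => rfl⟩
  smul_mem' := by
    rintro a f ⟨F, hFc, hFd, hF⟩
    exact ⟨a • F, hFc.const_smul a, hFd.const_smul a, fun z => by
      simp [ContinuousMap.smul_apply, hF z]⟩

open Filter Topology in
theorem weighted_comp_coeff_eq {U : Set ℂ} (hU : IsOpen U) {h g F P : ℂ → ℂ} {x μ : ℂ}
    (hx : x ∈ U) (hfix : h x = x)
    (hh : DifferentiableOn ℂ h U) (hg : ContinuousOn g U) (hF : ContinuousOn F U)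
    (hP : ContinuousOn P U) {n : ℕ}
    (H : ∀ z ∈ U, g z * ((h z - x) ^ n * F (h z)) - μ * ((z - x) ^ n * F z)
      = (z - x) ^ n * P z) :
    (g x * deriv h x ^ n - μ) * F x = P x := by
  have hUx : U ∈ 𝓝 x := hU.mem_nhds hx
  have hhd : DifferentiableAt ℂ h x := hh.differentiableAt hUx
  have hFx : ContinuousAt F x := hF.continuousAt hUx
  have hFh : ContinuousAt (fun z => F (h z)) x :=
    ContinuousAt.comp (by rw [hfix]; exact hFx) hhd.continuousAt
  have hds : ContinuousAt (dslope h x) x := continuousAt_dslope_same.2 hhd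
  have hL : ContinuousAt (fun z => g z * (dslope h x z ^ n * F (h z)) - μ * F z) x :=
    ((hg.continuousAt hUx).mul ((hds.pow n).mul hFh)).sub (continuousAt_const.mul hFx)
  have hPx : ContinuousAt P x := hP.continuousAt hUx
  have heq : (fun z => g z * (dslope h x z ^ n * F (h z)) - μ * F z) =ᶠ[𝓝[≠] x] P := by
    filter_upwards [self_mem_nhdsWithin, mem_nhdsWithin_of_mem_nhds hUx] with z hz hzU
    have hzx : z - x ≠ 0 := sub_ne_zero.2 hz
    have h1 : h z - x = (z - x) * dslope h x z := by
      have := sub_smul_dslope h x z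
      rw [hfix, smul_eq_mul] at this
      exact this.symm
    have h2 := H z hzU
    rw [h1, mul_pow] at h2
    apply mul_left_cancel₀ (pow_ne_zero n hzx)
    linear_combination h2
  have := tendsto_nhds_unique ((hL.tendsto.mono_left nhdsWithin_le_nhds).congr' heq)
    (hPx.tendsto.mono_left nhdsWithin_le_nhds)
  simp only [dslope_same, hfix] at this
  linear_combination this

/-- A solution of `g · (F ∘ h) - μ F = (z - x)ⁿ P` vanishes to order `n` at the fixed point `x`
when `μ` is none of the first `n` candidate eigenvalues. -/
theorem weighted_comp_exists_factor {U : Set ℂ} (hU : IsOpen U) {h g F : ℂ → ℂ} {x μ : ℂ}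
    (hx : x ∈ U) (hfix : h x = x) (hmaps : Set.MapsTo h U U)
    (hh : DifferentiableOn ℂ h U) (hg : ContinuousOn g U) (hF : DifferentiableOn ℂ F U)
    (n : ℕ) (hμ : ∀ k < n, g x * deriv h x ^ k ≠ μ) :
    ∀ P : ℂ → ℂ, ContinuousOn P U →
      (∀ z ∈ U, g z * F (h z) - μ * F z = (z - x) ^ n * P z) →
      ∃ G : ℂ → ℂ, DifferentiableOn ℂ G U ∧ (∀ z ∈ U, F z = (z - x) ^ n * G z) ∧
        (g x * deriv h x ^ n - μ) * G x = P x := by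
  induction n with
  | zero =>
    intro P hP H
    refine ⟨F, hF, fun z _ => by simp, ?_⟩
    exact weighted_comp_coeff_eq hU hx hfix hh hg hF.continuousOn hP (n := 0)
      fun z hz => by simpa using H z hz
  | succ n ih =>
    intro P hP H
    obtain ⟨G, hG, hFG, hGx⟩ := ih (fun k hk => hμ k (hk.trans n.lt_succ_self))
      (fun z => (z - x) * P z) ((continuousOn_id.sub continuousOn_const).mul hP)
      (fun z hz => by rw [H z hz]; ring)
    have hG0 : G x = 0 := by
      simp only [sub_self, zero_mul] at hGx
      exact (mul_eq_zero.1 hGx).resolve_left (sub_ne_zero.2 (hμ n n.lt_succ_self))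
    have hD : DifferentiableOn ℂ (dslope G x) U :=
      (Complex.differentiableOn_dslope (hU.mem_nhds hx)).2 hG
    have hfac : ∀ z ∈ U, F z = (z - x) ^ (n + 1) * dslope G x z := by
      intro z hz
      have := sub_smul_dslope G x z
      rw [hG0, sub_zero, smul_eq_mul] at this
      rw [hFG z hz, ← this]; ring
    refine ⟨dslope G x, hD, hfac, ?_⟩
    refine weighted_comp_coeff_eq hU hx hfix hh hg hD.continuousOn hP (n := n + 1) ?_
    intro z hz
    rw [← hfac z hz, ← hfac _ (hmaps hz), H z hz]

open Filter Topology in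
theorem eqOn_zero_of_forall_exists_pow_factor {U : Set ℂ} (hU : IsOpen U)
    (hUc : IsPreconnected U) {F : ℂ → ℂ} {x : ℂ} (hx : x ∈ U) (hF : DifferentiableOn ℂ F U)
    (H : ∀ n : ℕ, ∃ G : ℂ → ℂ, DifferentiableOn ℂ G U ∧ ∀ z ∈ U, F z = (z - x) ^ n * G z) :
    Set.EqOn F 0 U := by
  have hUx : U ∈ 𝓝 x := hU.mem_nhds hx
  have hA : AnalyticOnNhd ℂ F U := hF.analyticOnNhd hU
  refine hA.eqOn_zero_of_preconnected_of_eventuallyEq_zero hUc hx ?_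
  refine analyticOrderAt_eq_top.1 (ENat.eq_top_iff_forall_ge.2 fun n => ?_)
  obtain ⟨G, hG, hFG⟩ := H n
  rw [natCast_le_analyticOrderAt (hA x hx)]
  refine ⟨G, hG.analyticAt hUx, ?_⟩
  filter_upwards [hUx] with z hz
  simpa using hFG z hz

open Filter Topology in
theorem isClosed_discAlg (c : ℂ) (r : ℝ) :
    IsClosed (discAlg c r : Set C(closedBall c r, ℂ)) := by
  classical
  refine isClosed_of_closure_subset fun f hf => ?_
  obtain ⟨u, hu, hlim⟩ := mem_closure_iff_seq_limit.1 hf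
  choose F hFc hFd hF using hu
  let G : ℂ → ℂ := fun z => if hz : z ∈ closedBall c r then f ⟨z, hz⟩ else 0
  have hG : ∀ z : closedBall c r, f z = G z := fun z => by
    simp only [G, dif_pos z.2]
  have hunif : TendstoUniformlyOn F G atTop (closedBall c r) := by
    rw [Metric.tendstoUniformlyOn_iff]
    intro ε hε
    filter_upwards [(Metric.tendsto_nhds.1 hlim) ε hε] with n hn z hz
    have h1 := (ContinuousMap.dist_lt_iff hε).1 hn ⟨z, hz⟩
    rwa [hG, hF, dist_comm] at h1
  refine ⟨G, hunif.continuousOn (Frequently.of_forall hFc), ?_, hG⟩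
  exact (hunif.mono ball_subset_closedBall).tendstoLocallyUniformlyOn.differentiableOn
    (Eventually.of_forall hFd) isOpen_ball

theorem discAlg_norm_apply_le {c : ℂ} {r : ℝ} (f : discAlg c r) (z : closedBall c r) :
    ‖(f : C(closedBall c r, ℂ)) z‖ ≤ ‖f‖ :=
  ContinuousMap.norm_coe_le_norm (f : C(closedBall c r, ℂ)) z

/-- The element of `A_∞` given by a function continuous on the closed disk and holomorphic
inside. -/
noncomputable def discAlgMk {c : ℂ} {r : ℝ} (F : ℂ → ℂ) (hc : ContinuousOn F (closedBall c r))
    (hd : DifferentiableOn ℂ F (ball c r)) : discAlg c r :=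
  ⟨⟨fun z => F z, hc.domRestrict⟩, F, hc, hd, fun _ => rfl⟩

open Filter Topology in
theorem weighted_comp_isCompactOperator {c : ℂ} {r : ℝ} {h g : ℂ → ℂ}
    (hhc : ContinuousOn h (closedBall c r)) (hgc : ContinuousOn g (closedBall c r))
    (hmaps : Set.MapsTo h (closedBall c r) (ball c r))
    (T : discAlg c r →L[ℂ] discAlg c r)
    (hT : ∀ (f : discAlg c r) (z : closedBall c r),
      ((T f : C(closedBall c r, ℂ)) z)
        = g z * (f : C(closedBall c r, ℂ)) ⟨h z, ball_subset_closedBall (hmaps z.2)⟩) :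
    IsCompactOperator T := by
  let ι : C(closedBall c r, ℂ) ≃ᵢ BoundedContinuousFunction (closedBall c r) ℂ :=
    ContinuousMap.isometryEquivBoundedOfCompact _ _
  let S : discAlg c r →L[ℂ] C(closedBall c r, ℂ) := (discAlg c r).subtypeL.comp T
  let A : Set (BoundedContinuousFunction (closedBall c r) ℂ) := ι '' (S '' closedBall 0 1)
  have hA : IsCompact (closure A) := by
    refine BoundedContinuousFunction.arzela_ascoli (closedBall (0 : ℂ) ‖T‖)
      (isCompact_closedBall _ _) A ?_ ?_
    · rintro _ z ⟨_, ⟨f, hf, rfl⟩, rfl⟩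
      rw [mem_closedBall_zero_iff] at hf ⊢
      calc ‖(T f : C(closedBall c r, ℂ)) z‖ ≤ ‖T f‖ := discAlg_norm_apply_le _ _
        _ ≤ ‖T‖ * ‖f‖ := T.le_opNorm f
        _ ≤ ‖T‖ := mul_le_of_le_one_right T.opNorm_nonneg hf
    · intro x
      let δ : ℝ := r - dist (h x) c
      have hδ : 0 < δ := sub_pos.2 (hmaps x.2)
      have hhr : Continuous fun z : closedBall c r => h z := hhc.domRestrict
      have hgr : Continuous fun z : closedBall c r => g z := hgc.domRestrict
      let b : closedBall c r → ℝ := fun z =>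
        ‖g x - g z‖ + ‖g z‖ * (2 / δ * dist (h z) (h x))
      have hb : Tendsto b (𝓝 x) (𝓝 0) := by
        have : Continuous b := (continuous_const.sub hgr).norm.add
          (hgr.norm.mul (continuous_const.mul (hhr.dist continuous_const)))
        simpa [b] using this.tendsto x
      refine Metric.equicontinuousAt_of_continuity_modulus b hb _ ?_
      filter_upwards [hhr.continuousAt.preimage_mem_nhds (ball_mem_nhds (h x) hδ)] with z hz
      rintro ⟨_, _, ⟨f, hf, rfl⟩, rfl⟩
      rw [mem_closedBall_zero_iff] at hf
      change dist ((T f : C(closedBall c r, ℂ)) x) ((T f : C(closedBall c r, ℂ)) z) ≤ b z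
      obtain ⟨F, hFc, hFd, hF⟩ := f.2
      have hFn : ∀ w ∈ closedBall c r, ‖F w‖ ≤ 1 := fun w hw => by
        rw [← hF ⟨w, hw⟩]
        exact (discAlg_norm_apply_le f ⟨w, hw⟩).trans hf
      have hsub : ball (h x) δ ⊆ ball c r := ball_subset_ball' (by simp [δ])
      have hSchwarz : dist (F (h z)) (F (h x)) ≤ 2 / δ * dist (h z) (h x) := by
        refine Complex.dist_le_div_mul_dist_of_mapsTo_ball (hFd.mono hsub) ?_ hz
        intro w hw
        rw [mem_closedBall, dist_eq_norm]
        have h1 := hFn w (ball_subset_closedBall (hsub hw))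
        have h2 := hFn (h x) (ball_subset_closedBall (hmaps x.2))
        linarith [norm_sub_le (F w) (F (h x))]
      rw [hT, hT, hF, hF, dist_eq_norm]
      have hsplit : g x * F (h x) - g z * F (h z)
          = (g x - g z) * F (h x) - g z * (F (h z) - F (h x)) := by ring
      change ‖g x * F (h x) - g z * F (h z)‖ ≤ b z
      rw [hsplit]
      refine (norm_sub_le _ _).trans (add_le_add ?_ ?_)
      · rw [norm_mul]
        exact mul_le_of_le_one_right (norm_nonneg _)
          (hFn _ (ball_subset_closedBall (hmaps x.2)))
      · rw [norm_mul, ← dist_eq_norm (F (h z))]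
        exact mul_le_mul_of_nonneg_left hSchwarz (norm_nonneg _)
  have hS : IsCompactOperator S := by
    refine (isCompactOperator_iff_image_closedBall_subset_compact
      (S : discAlg c r →ₗ[ℂ] C(closedBall c r, ℂ)) one_pos).2
      ⟨ι.symm '' closure A, hA.image ι.symm.continuous, ?_⟩
    rintro _ ⟨f, hf, rfl⟩
    exact ⟨ι (S f), subset_closure ⟨_, ⟨f, hf, rfl⟩, rfl⟩, ι.symm_apply_apply _⟩
  exact hS.codRestrict (fun f => (T f).2) (isClosed_discAlg c r)

open Filter Topology in
theorem zero_mem_spectrum_weighted_comp {c : ℂ} {r : ℝ} (hr : 0 < r) {h g : ℂ → ℂ}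
    (hhc : ContinuousOn h (closedBall c r)) (hgc : ContinuousOn g (closedBall c r))
    (hmaps : Set.MapsTo h (closedBall c r) (ball c r))
    (T : discAlg c r →L[ℂ] discAlg c r)
    (hT : ∀ (f : discAlg c r) (z : closedBall c r),
      ((T f : C(closedBall c r, ℂ)) z)
        = g z * (f : C(closedBall c r, ℂ)) ⟨h z, ball_subset_closedBall (hmaps z.2)⟩) :
    (0 : ℂ) ∈ spectrum ℂ T := by
  rw [spectrum.zero_mem_iff]
  rintro ⟨u, hu⟩
  have hne : (closedBall c r).Nonempty := ⟨c, mem_closedBall_self hr.le⟩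
  obtain ⟨w, hw, hmax⟩ := (isCompact_closedBall c r).exists_isMaxOn hne
    (f := fun z => dist (h z) c) ((continuous_id.dist continuous_const).comp_continuousOn hhc)
  obtain ⟨M, hM⟩ := (isCompact_closedBall c r).exists_bound_of_continuousOn hgc
  have hM0 : 0 ≤ M := (norm_nonneg _).trans (hM c (mem_closedBall_self hr.le))
  let q : ℝ := dist (h w) c / r
  have hq0 : 0 ≤ q := by positivity
  have hq1 : q < 1 := (div_lt_one hr).2 (hmaps hw)
  let p : ℕ → ℂ → ℂ := fun n z => ((z - c) / r) ^ n
  have hp : ∀ n, Differentiable ℂ (p n) := fun n => by fun_prop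
  let f : ℕ → discAlg c r := fun n =>
    discAlgMk (p n) (hp n).continuous.continuousOn (hp n).differentiableOn
  have hTf : ∀ n, ‖T (f n)‖ ≤ M * q ^ n := by
    intro n
    refine (ContinuousMap.norm_le _ (by positivity)).2 fun z => ?_
    change ‖(T (f n) : C(closedBall c r, ℂ)) z‖ ≤ _
    rw [hT, norm_mul]
    refine mul_le_mul (hM z z.2) ?_ (norm_nonneg _) hM0
    change ‖((h z - c) / r) ^ n‖ ≤ q ^ n
    rw [norm_pow, norm_div, ← dist_eq_norm, Complex.norm_real, Real.norm_of_nonneg hr.le]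
    exact pow_le_pow_left₀ (by positivity) (div_le_div_of_nonneg_right (hmax z.2) hr.le) n
  have hf1 : ∀ n, 1 ≤ ‖f n‖ := by
    intro n
    have hmem : c + r ∈ closedBall c r := by simp [abs_of_pos hr]
    refine le_trans (le_of_eq ?_) (discAlg_norm_apply_le (f n) ⟨c + r, hmem⟩)
    change 1 = ‖((c + r - c) / r : ℂ) ^ n‖
    have : (r : ℂ) ≠ 0 := by exact_mod_cast hr.ne'
    simp [this]
  have hinv : ∀ n, 1 ≤ ‖(↑u⁻¹ : discAlg c r →L[ℂ] discAlg c r)‖ * (M * q ^ n) := by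
    intro n
    have h1 : (↑u⁻¹ : discAlg c r →L[ℂ] discAlg c r) (T (f n)) = f n := by
      rw [← hu, ← mul_apply_eq_comp, Units.inv_mul, one_apply_eq_self]
    calc 1 ≤ ‖f n‖ := hf1 n
      _ = ‖(↑u⁻¹ : discAlg c r →L[ℂ] discAlg c r) (T (f n))‖ := by rw [h1]
      _ ≤ _ := (ContinuousLinearMap.le_opNorm _ _).trans
        (mul_le_mul_of_nonneg_left (hTf n) (norm_nonneg _))
  have hlim : Tendsto (fun n : ℕ => ‖(↑u⁻¹ : discAlg c r →L[ℂ] discAlg c r)‖ * (M * q ^ n))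
      atTop (𝓝 0) := by
    simpa using ((tendsto_pow_atTop_nhds_zero_of_lt_one hq0 hq1).const_mul M).const_mul
      ‖(↑u⁻¹ : discAlg c r →L[ℂ] discAlg c r)‖
  exact absurd (ge_of_tendsto' hlim hinv) (by norm_num)

/-- Spectrum of the weighted composition operator `f ↦ g · (f ∘ h)` on
`A_∞(𝒱)`, where `h(𝒱̄) ⊂ 𝒱`: it equals `{g(x_h)·(h'(x_h))ⁿ : n ≥ 0} ∪ {0}`,
`x_h` being the unique fixed point of `h` in `𝒱`. -/
theorem stmt12 (c₀ : ℂ) (r : ℝ) (hr : 0 < r) (h g : ℂ → ℂ)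
    (hhc : ContinuousOn h (closedBall c₀ r))
    (hhd : DifferentiableOn ℂ h (ball c₀ r))
    (hgc : ContinuousOn g (closedBall c₀ r))
    (hgd : DifferentiableOn ℂ g (ball c₀ r))
    (hmaps : Set.MapsTo h (closedBall c₀ r) (ball c₀ r))
    (xh : ℂ) (hxh : xh ∈ ball c₀ r) (hfix : h xh = xh)
    (T : discAlg c₀ r →L[ℂ] discAlg c₀ r)
    (hT : ∀ (f : discAlg c₀ r) (z : closedBall c₀ r),
      ((T f : C(closedBall c₀ r, ℂ)) z)
        = g z * (f : C(closedBall c₀ r, ℂ)) ⟨h z, ball_subset_closedBall (hmaps z.2)⟩) :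
    spectrum ℂ T = {μ : ℂ | ∃ n : ℕ, μ = g xh * (deriv h xh) ^ n} ∪ {0} := by
  have hmapsB : Set.MapsTo h (ball c₀ r) (ball c₀ r) := hmaps.mono_left ball_subset_closedBall
  have hgB : ContinuousOn g (ball c₀ r) := hgd.continuousOn
  have h0 : (0 : ℂ) ∈ spectrum ℂ T := zero_mem_spectrum_weighted_comp hr hhc hgc hmaps T hT
  apply Set.Subset.antisymm
  · intro μ hμ
    by_contra hnot
    rw [Set.mem_union, not_or] at hnot
    obtain ⟨hn, hμ0⟩ := hnot
    have hn' : ∀ n : ℕ, g xh * deriv h xh ^ n ≠ μ := fun n hh => hn ⟨n, hh.symm⟩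
    have := (isClosed_discAlg c₀ r).completeSpace_coe
    have hcomp := weighted_comp_isCompactOperator hhc hgc hmaps T hT
    obtain ⟨f, hf⟩ := ((hcomp.hasEigenvalue_iff_mem_spectrum hμ0).2 hμ).exists_hasEigenvector
    have hTf : T f = μ • f := hf.apply_eq_smul
    obtain ⟨F, hFc, hFd, hF⟩ := f.2
    have hpt : ∀ z ∈ ball c₀ r, g z * F (h z) - μ * F z = 0 := by
      intro z hz
      have h1 := hT f ⟨z, ball_subset_closedBall hz⟩
      rw [hTf, hF] at h1
      change μ * (f : C(closedBall c₀ r, ℂ)) ⟨z, _⟩ = _ at h1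
      rw [hF] at h1
      exact sub_eq_zero.2 h1.symm
    have hzero : Set.EqOn F 0 (ball c₀ r) := by
      refine eqOn_zero_of_forall_exists_pow_factor isOpen_ball
        (convex_ball c₀ r).isPreconnected hxh hFd fun n => ?_
      obtain ⟨G, hG, hFG, -⟩ := weighted_comp_exists_factor isOpen_ball hxh hfix hmapsB hhd hgB
        hFd n (fun k _ => hn' k) (fun _ => 0) continuousOn_const
        (fun z hz => by rw [hpt z hz, mul_zero])
      exact ⟨G, hG, hFG⟩
    have hzero' : Set.EqOn F 0 (closedBall c₀ r) :=
      hzero.of_subset_closure hFc continuousOn_const ball_subset_closedBall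
        (closure_ball c₀ hr.ne').ge
    refine hf.2 (Subtype.ext (ContinuousMap.ext fun z => ?_))
    rw [hF z, hzero' z.2]
    rfl
  · rintro μ (⟨n, hμn⟩ | rfl)
    swap
    · exact h0
    classical
    have hex : ∃ n : ℕ, g xh * deriv h xh ^ n = μ := ⟨n, hμn.symm⟩
    let N := Nat.find hex
    have hN : g xh * deriv h xh ^ N = μ := Nat.find_spec hex
    have hmin : ∀ k < N, g xh * deriv h xh ^ k ≠ μ := fun k hk => Nat.find_min hex hk
    rw [spectrum.mem_iff]
    intro hunit
    have hp : Differentiable ℂ fun z : ℂ => (z - xh) ^ N := by fun_prop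
    obtain ⟨u, hu⟩ := hunit
    let e : discAlg c₀ r :=
      discAlgMk _ hp.continuous.continuousOn hp.differentiableOn
    let f : discAlg c₀ r := (↑u⁻¹ : discAlg c₀ r →L[ℂ] discAlg c₀ r) e
    have hf : μ • f - T f = e := by
      have h1 : (↑u : discAlg c₀ r →L[ℂ] discAlg c₀ r) f = e := by
        rw [← mul_apply_eq_comp, Units.mul_inv, one_apply_eq_self]
      rw [hu] at h1
      simpa [Algebra.algebraMap_eq_smul_one] using h1
    obtain ⟨F, hFc, hFd, hF⟩ := f.2
    obtain ⟨G, -, -, hG⟩ := weighted_comp_exists_factor isOpen_ball hxh hfix hmapsB hhd hgB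
      hFd N hmin (fun _ => -1) continuousOn_const (fun z hz => by
        have h1 : μ * (f : C(closedBall c₀ r, ℂ)) ⟨z, ball_subset_closedBall hz⟩
            - (T f : C(closedBall c₀ r, ℂ)) ⟨z, ball_subset_closedBall hz⟩ = (z - xh) ^ N :=
          congrArg (fun k : discAlg c₀ r =>
            (k : C(closedBall c₀ r, ℂ)) ⟨z, ball_subset_closedBall hz⟩) hf
        rw [hT, hF, hF] at h1
        change μ * F z - g z * F (h z) = _ at h1
        linear_combination -h1)
    rw [hN, sub_self, zero_mul] at hG
    norm_num at hG
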